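/- Let β > −1, γ > 0, δ > 0, let N ≥ 1 and let U : ℝ → ℝ be N times continuously differentiable with all derivatives of order 0, 1, ..., N uniformly bounded. Then for every η ∈ ℝ, | I^{β,γ}_δ U(η) − Σ_{k=0}^{N−1} λ_k U^(k)(η) η^k / k! | ≤ ‖U^(N)‖_∞ |λ_N| |η|^N / N!, where ‖U^(N)‖_∞ denotes the supremum norm of the N-th derivative of U. -/

import Mathlib

/-- The Erdélyi–Kober fractional integral
`I^{β,γ}_δ U(η) = (1/Γ(γ)) ∫_0^1 (1−z)^{γ−1} z^β U(η z^{1/δ}) dz`. -/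
noncomputable def erdelyiKober (β γ δ : ℝ) (U : ℝ → ℝ) (η : ℝ) : ℝ :=
  (1 / Real.Gamma γ) * ∫ z in (0:ℝ)..1, (1 - z) ^ (γ - 1) * z ^ β * U (η * z ^ (1 / δ))

/-- The coefficients
`λ_k = ((−1)^k/Γ(γ)) ∫_0^1 (1−z)^{γ−1} z^β (1−z^{1/δ})^k dz`. -/
noncomputable def ekCoeff (β γ δ : ℝ) (k : ℕ) : ℝ :=
  ((-1 : ℝ) ^ k / Real.Gamma γ) *
    ∫ z in (0:ℝ)..1, (1 - z) ^ (γ - 1) * z ^ β * (1 - z ^ (1 / δ)) ^ k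

/-- **Taylor's theorem** with a global bound on the last derivative. -/
lemma abs_sub_taylor_sum_le {U : ℝ → ℝ} {N : ℕ} (hN : 1 ≤ N) (hU : ContDiff ℝ N U) {C : ℝ}
    (hC : ∀ x, |iteratedDeriv N U x| ≤ C) (x₀ x : ℝ) :
    |U x - ∑ k ∈ Finset.range N, iteratedDeriv k U x₀ / (k.factorial : ℝ) * (x - x₀) ^ k|
      ≤ C * |x - x₀| ^ N / (N.factorial : ℝ) := by
  obtain ⟨n, rfl⟩ : ∃ n, N = n + 1 := ⟨N - 1, by omega⟩
  rcases eq_or_ne x₀ x with rfl | hx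
  · simp [Finset.sum_range_succ']
  · obtain ⟨y, -, hy⟩ := taylor_mean_remainder_lagrange_iteratedDeriv (n := n) hx
      (by exact_mod_cast hU.contDiffOn)
    have hsum : taylorWithinEval U n (Set.uIcc x₀ x) x₀ x =
        ∑ k ∈ Finset.range (n + 1),
          iteratedDeriv k U x₀ / (k.factorial : ℝ) * (x - x₀) ^ k := by
      rw [taylor_within_apply]
      refine Finset.sum_congr rfl fun k hk => ?_
      rw [iteratedDerivWithin_eq_iteratedDeriv (uniqueDiffOn_uIcc hx)
        (hU.contDiffAt.of_le (by exact_mod_cast (Finset.mem_range.1 hk).le)) Set.left_mem_uIcc,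
        smul_eq_mul]
      ring
    rw [← hsum, hy, abs_div, abs_mul, abs_pow, Nat.abs_cast]
    gcongr
    exact hC y

/-- The weight of the Erdélyi–Kober operator is integrable on `[0, 1]`. -/
lemma intervalIntegrable_one_sub_rpow_mul_rpow {β γ : ℝ} (hβ : -1 < β) (hγ : 0 < γ) :
    IntervalIntegrable (fun z : ℝ => (1 - z) ^ (γ - 1) * z ^ β) MeasureTheory.volume 0 1 := by
  have left {a : ℝ} (ha : -1 < a) (b : ℝ) :
      IntervalIntegrable (fun z : ℝ => z ^ a * (1 - z) ^ b) MeasureTheory.volume 0 (1 / 2) := by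
    refine (intervalIntegral.intervalIntegrable_rpow' ha).mul_continuousOn ?_
    refine ContinuousOn.rpow_const (by fun_prop) fun z hz => Or.inl ?_
    rw [Set.uIcc_of_le (by norm_num)] at hz
    linarith [hz.2]
  have hr := ((left (a := γ - 1) (by linarith) β).comp_sub_left 1).symm
  refine (by simpa only [mul_comm] using left hβ (γ - 1) : IntervalIntegrable
    (fun z : ℝ => (1 - z) ^ (γ - 1) * z ^ β) MeasureTheory.volume 0 (1 / 2)).trans ?_
  convert hr using 1
  · ext z
    simp
  · norm_num
  · norm_num

/-- truncation-error estimate for the `N`-term approximation of the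
Erdélyi–Kober operator, for `C^N` functions with uniformly bounded derivatives.
Here `⨆ x, |iteratedDeriv N U x|` is the supremum norm `‖U^(N)‖_∞`. -/
theorem ek_truncation_error (β γ δ : ℝ) (hβ : -1 < β) (hγ : 0 < γ) (hδ : 0 < δ)
    (N : ℕ) (hN : 1 ≤ N) (U : ℝ → ℝ) (hU : ContDiff ℝ N U)
    (hbdd : ∃ M : ℝ, ∀ k ≤ N, ∀ x : ℝ, |iteratedDeriv k U x| ≤ M) :
    ∀ η : ℝ,
      |erdelyiKober β γ δ U η -
          ∑ k ∈ Finset.range N, ekCoeff β γ δ k * iteratedDeriv k U η * η ^ k / (k.factorial : ℝ)|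
        ≤ (⨆ x : ℝ, |iteratedDeriv N U x|) * |ekCoeff β γ δ N| * |η| ^ N / (N.factorial : ℝ) := by
  intro η
  obtain ⟨M, hM⟩ := hbdd
  set C : ℝ := ⨆ x : ℝ, |iteratedDeriv N U x|
  have hC : ∀ x, |iteratedDeriv N U x| ≤ C := fun x =>
    le_ciSup (f := fun x => |iteratedDeriv N U x|)
      ⟨M, by rintro _ ⟨y, rfl⟩; exact hM N le_rfl y⟩ x
  have hΓ : 0 < Real.Gamma γ := Real.Gamma_pos_of_pos hγ
  have hs : Continuous fun z : ℝ => z ^ (1 / δ) := Real.continuous_rpow_const (by positivity)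
  have hW := intervalIntegrable_one_sub_rpow_mul_rpow hβ hγ
  have hint {g : ℝ → ℝ} (hg : Continuous g) :
      IntervalIntegrable (fun z : ℝ => (1 - z) ^ (γ - 1) * z ^ β * g z)
        MeasureTheory.volume 0 1 := hW.mul_continuousOn hg.continuousOn
  have hUc : Continuous U := hU.continuous
  have hterm (k : ℕ) : ekCoeff β γ δ k * iteratedDeriv k U η * η ^ k / (k.factorial : ℝ) =
      (1 / Real.Gamma γ) * ∫ z in (0:ℝ)..1, (1 - z) ^ (γ - 1) * z ^ β *
        (iteratedDeriv k U η / (k.factorial : ℝ) * (η * z ^ (1 / δ) - η) ^ k) := by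
    have h (z : ℝ) : (1 - z) ^ (γ - 1) * z ^ β *
        (iteratedDeriv k U η / (k.factorial : ℝ) * (η * z ^ (1 / δ) - η) ^ k) =
        (iteratedDeriv k U η / (k.factorial : ℝ) * η ^ k * (-1) ^ k) *
          ((1 - z) ^ (γ - 1) * z ^ β * (1 - z ^ (1 / δ)) ^ k) := by
      rw [show η * z ^ (1 / δ) - η = η * (-1) * (1 - z ^ (1 / δ)) by ring, mul_pow, mul_pow]
      ring
    simp_rw [h]
    rw [intervalIntegral.integral_const_mul, ekCoeff]
    ring
  have herr : erdelyiKober β γ δ U η -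
      ∑ k ∈ Finset.range N, ekCoeff β γ δ k * iteratedDeriv k U η * η ^ k / (k.factorial : ℝ) =
      (1 / Real.Gamma γ) * ∫ z in (0:ℝ)..1, (1 - z) ^ (γ - 1) * z ^ β *
        (U (η * z ^ (1 / δ)) - ∑ k ∈ Finset.range N,
          iteratedDeriv k U η / (k.factorial : ℝ) * (η * z ^ (1 / δ) - η) ^ k) := by
    simp_rw [hterm, mul_sub, Finset.mul_sum (Finset.range N)]
    rw [← Finset.mul_sum, intervalIntegral.integral_sub (hint (by fun_prop)),
      intervalIntegral.integral_finsetSum, erdelyiKober, mul_sub]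
    · exact fun k _ => hint (by fun_prop)
    · simp_rw [← Finset.mul_sum]
      exact hint (by fun_prop)
  have hcoeff : |ekCoeff β γ δ N| = (1 / Real.Gamma γ) *
      ∫ z in (0:ℝ)..1, (1 - z) ^ (γ - 1) * z ^ β * (1 - z ^ (1 / δ)) ^ N := by
    have hnonneg : 0 ≤ ∫ z in (0:ℝ)..1,
        (1 - z) ^ (γ - 1) * z ^ β * (1 - z ^ (1 / δ)) ^ N := by
      refine intervalIntegral.integral_nonneg zero_le_one fun z hz => ?_
      have h1 : 0 ≤ 1 - z := sub_nonneg.2 hz.2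
      have h2 : 0 ≤ 1 - z ^ (1 / δ) :=
        sub_nonneg.2 (Real.rpow_le_one hz.1 hz.2 (by positivity))
      exact mul_nonneg (mul_nonneg (Real.rpow_nonneg h1 _) (Real.rpow_nonneg hz.1 _))
        (pow_nonneg h2 _)
    rw [ekCoeff, abs_mul, abs_div, abs_pow, abs_neg, abs_one, one_pow, abs_of_pos hΓ,
      abs_of_nonneg hnonneg]
  have hbound : |∫ z in (0:ℝ)..1, (1 - z) ^ (γ - 1) * z ^ β *
        (U (η * z ^ (1 / δ)) - ∑ k ∈ Finset.range N,
          iteratedDeriv k U η / (k.factorial : ℝ) * (η * z ^ (1 / δ) - η) ^ k)| ≤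
      ∫ z in (0:ℝ)..1, C * |η| ^ N / (N.factorial : ℝ) *
        ((1 - z) ^ (γ - 1) * z ^ β * (1 - z ^ (1 / δ)) ^ N) := by
    rw [← Real.norm_eq_abs]
    refine intervalIntegral.norm_integral_le_of_norm_le zero_le_one
      (Filter.Eventually.of_forall fun z hz => ?_)
      ((hint (g := fun z => (1 - z ^ (1 / δ)) ^ N) (by fun_prop)).const_mul _)
    have hw : 0 ≤ (1 - z) ^ (γ - 1) * z ^ β :=
      mul_nonneg (Real.rpow_nonneg (sub_nonneg.2 hz.2) _) (Real.rpow_nonneg hz.1.le _)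
    have h2 : 0 ≤ 1 - z ^ (1 / δ) :=
      sub_nonneg.2 (Real.rpow_le_one hz.1.le hz.2 (by positivity))
    have habs : |η * z ^ (1 / δ) - η| = |η| * (1 - z ^ (1 / δ)) := by
      rw [show η * z ^ (1 / δ) - η = -(η * (1 - z ^ (1 / δ))) by ring, abs_neg, abs_mul,
        abs_of_nonneg h2]
    rw [Real.norm_eq_abs, abs_mul, abs_of_nonneg hw]
    refine (mul_le_mul_of_nonneg_left
      (abs_sub_taylor_sum_le hN hU hC η (η * z ^ (1 / δ))) hw).trans_eq ?_
    rw [habs, mul_pow]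
    ring
  rw [intervalIntegral.integral_const_mul] at hbound
  rw [herr, hcoeff, abs_mul, abs_of_pos (one_div_pos.2 hΓ)]
  refine (mul_le_mul_of_nonneg_left hbound (one_div_pos.2 hΓ).le).trans_eq ?_
  ring
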